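/- Let P, Q ∈ ℝ³. There exist infinitely many tropical lines in ℝ³ containing both P and Q if and only if at least one coordinate of the vector Q − P is zero or at least two of its coordinates are equal. In all other cases (i.e., when the three coordinates of Q − P are nonzero and pairwise distinct), there exists exactly one tropical line containing both P and Q. -/

import Mathlib

/-- The ray from `v` in direction `d`. -/
def tropRay (v d : Fin 3 → ℝ) : Set (Fin 3 → ℝ) :=
  {x | ∃ s : ℝ, 0 ≤ s ∧ x = v + s • d}

/-- The four directions of the rays of a tropical line in ℝ³. -/
noncomputable def tropDir : Fin 4 → (Fin 3 → ℝ) :=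
  ![![-1, 0, 0], ![0, -1, 0], ![0, 0, -1], ![1, 1, 1]]

/-- A degenerate tropical line: four rays with directions ω₁,…,ω₄ from a common vertex. -/
def IsDegenerateTropicalLine (L : Set (Fin 3 → ℝ)) : Prop :=
  ∃ v : Fin 3 → ℝ, L = ⋃ i : Fin 4, tropRay v (tropDir i)

/-- A non-degenerate tropical line: two rays from a vertex `v`, a bounded segment from `v` to
`w = v + t • (ω_k + ω_l)` with `t > 0`, and two rays from `w`. -/
def IsNonDegenerateTropicalLine (L : Set (Fin 3 → ℝ)) : Prop :=
  ∃ (v : Fin 3 → ℝ) (t : ℝ) (i j k l : Fin 4),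
    0 < t ∧ ({i, j, k, l} : Set (Fin 4)) = Set.univ ∧
    L = tropRay v (tropDir i) ∪ tropRay v (tropDir j) ∪
        segment ℝ v (v + t • (tropDir k + tropDir l)) ∪
        tropRay (v + t • (tropDir k + tropDir l)) (tropDir k) ∪
        tropRay (v + t • (tropDir k + tropDir l)) (tropDir l)

/-- A tropical line in ℝ³. -/
def IsTropicalLine (L : Set (Fin 3 → ℝ)) : Prop :=
  IsDegenerateTropicalLine L ∨ IsNonDegenerateTropicalLine L

/-- Homogeneous coordinates of a point. -/
def hom (x : Fin 3 → ℝ) : Fin 4 → ℝ := ![x 0, x 1, x 2, 0]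

lemma hom_add_dir (x : Fin 3 → ℝ) (s : ℝ) (i m : Fin 4) :
    hom (x + s • tropDir i) m
      = hom x m - (if m = i then s else 0) + (if i = 3 then s else 0) := by
  fin_cases i <;> fin_cases m <;> simp [hom, tropDir] <;> ring

lemma hom_ext {x y : Fin 3 → ℝ} (c : ℝ) (h : ∀ m, hom x m = hom y m + c) : x = y := by
  have h0 := h 0
  have h1 := h 1
  have h2 := h 2
  have h3 := h 3
  simp [hom] at h0 h1 h2 h3
  subst h3
  funext m
  fin_cases m <;> simp_all

/-- The indices `i, j, k, l` are pairwise distinct. -/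
def Dist4 (i j k l : Fin 4) : Prop :=
  i ≠ j ∧ i ≠ k ∧ i ≠ l ∧ j ≠ k ∧ j ≠ l ∧ k ≠ l

lemma Dist4.cover {i j k l : Fin 4} (h : Dist4 i j k l) (m : Fin 4) :
    m = i ∨ m = j ∨ m = k ∨ m = l := by
  unfold Dist4 at h
  revert i j k l m
  decide

lemma dist4_iff (i j k l : Fin 4) :
    ({i, j, k, l} : Set (Fin 4)) = Set.univ ↔ Dist4 i j k l := by
  have e : ({i, j, k, l} : Set (Fin 4)) = Set.univ ↔
      ∀ m : Fin 4, m = i ∨ m = j ∨ m = k ∨ m = l := by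
    simp [Set.eq_univ_iff_forall]
  rw [e]
  constructor
  · clear e
    unfold Dist4
    revert i j k l
    decide
  · intro h m
    exact h.cover m

lemma mem_tropRay {i j k l : Fin 4} (h : Dist4 i j k l) (v x : Fin 3 → ℝ) :
    x ∈ tropRay v (tropDir i) ↔
      hom x j - hom v j = hom x k - hom v k ∧ hom x k - hom v k = hom x l - hom v l ∧
      hom x i - hom v i ≤ hom x j - hom v j := by
  have hc := h.cover
  obtain ⟨hij, hik, hil, hjk, hjl, hkl⟩ := h
  constructor
  · rintro ⟨s, hs, rfl⟩
    simp only [hom_add_dir, hij.symm, hik.symm, hil.symm, if_false, if_true]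
    refine ⟨by ring, by ring, by linarith⟩
  · rintro ⟨h1, h2, h3⟩
    refine ⟨(hom x j - hom v j) - (hom x i - hom v i), by linarith, ?_⟩
    refine hom_ext ((hom x j - hom v j) - (if i = 3 then
      (hom x j - hom v j) - (hom x i - hom v i) else 0)) ?_
    intro m
    rw [hom_add_dir]
    rcases hc m with rfl | rfl | rfl | rfl
    · simp only [if_true]; linarith
    · simp only [hij.symm, if_false]; linarith
    · simp only [hik.symm, if_false]; linarith
    · simp only [hil.symm, if_false]; linarith

lemma hom_w (v : Fin 3 → ℝ) (t : ℝ) (k l m : Fin 4) :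
    hom (v + t • (tropDir k + tropDir l)) m = hom v m - (if m = k then t else 0)
      - (if m = l then t else 0) + ((if k = 3 then t else 0) + (if l = 3 then t else 0)) := by
  rw [smul_add, ← add_assoc, hom_add_dir, hom_add_dir]
  ring

lemma mem_seg {i j k l : Fin 4} (h : Dist4 i j k l) (v x : Fin 3 → ℝ) {t : ℝ} (ht : 0 < t) :
    x ∈ segment ℝ v (v + t • (tropDir k + tropDir l)) ↔
      hom x i - hom v i = hom x j - hom v j ∧ hom x k - hom v k = hom x l - hom v l ∧
      hom x k - hom v k ≤ hom x i - hom v i ∧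
      hom x i - hom v i ≤ hom x k - hom v k + t := by
  have hc := h.cover
  obtain ⟨hij, hik, hil, hjk, hjl, hkl⟩ := h
  rw [segment_eq_image']
  constructor
  · rintro ⟨θ, ⟨h0, h1⟩, rfl⟩
    have a1 : 0 ≤ θ * t := by positivity
    have a2 : θ * t ≤ t := by nlinarith
    simp only [add_sub_cancel_left, smul_smul, hom_w, hik, hil, hjk, hjl, hkl, hkl.symm,
      if_false, if_true]
    refine ⟨by ring, by ring, by linarith, by linarith⟩
  · rintro ⟨h1, h2, h3, h4⟩
    refine ⟨((hom x i - hom v i) - (hom x k - hom v k)) / t,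
      ⟨div_nonneg (by linarith) ht.le, (div_le_one ht).2 (by linarith)⟩, ?_⟩
    simp only [add_sub_cancel_left, smul_smul]
    rw [div_mul_cancel₀ _ ht.ne']
    symm
    set r := (hom x i - hom v i) - (hom x k - hom v k) with hr
    refine hom_ext ((hom x i - hom v i) -
      ((if k = 3 then r else 0) + (if l = 3 then r else 0))) ?_
    intro m
    rw [hom_w]
    rcases hc m with rfl | rfl | rfl | rfl
    · simp only [hik, hil, if_false]; linarith
    · simp only [hjk, hjl, if_false]; linarith
    · simp only [hkl, if_false, if_true]; linarith
    · simp only [hkl.symm, if_false, if_true]; linarith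

/-- Coordinate description of a tropical line with cells `ij | kl`, vertex with homogeneous
coordinates `a b c d` (at `i, j, k, l`) and bounded edge of length `t`. -/
def TL (i j k l : Fin 4) (a b c d t : ℝ) : Set (Fin 3 → ℝ) :=
  {x | (hom x j - b = hom x k - c ∧ hom x k - c = hom x l - d ∧ hom x i - a ≤ hom x j - b) ∨
    (hom x i - a = hom x k - c ∧ hom x k - c = hom x l - d ∧ hom x j - b ≤ hom x i - a) ∨
    (hom x i - a = hom x j - b ∧ hom x k - c = hom x l - d ∧ hom x k - c ≤ hom x i - a ∧
      hom x i - a ≤ hom x k - c + t) ∨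
    (hom x i - a = hom x j - b ∧ hom x j - b = hom x l - d + t ∧ hom x k - c ≤ hom x l - d) ∨
    (hom x i - a = hom x j - b ∧ hom x j - b = hom x k - c + t ∧ hom x l - d ≤ hom x k - c)}

lemma nondeg_eq {i j k l : Fin 4} (h : Dist4 i j k l) (v : Fin 3 → ℝ) {t : ℝ} (ht : 0 < t) :
    tropRay v (tropDir i) ∪ tropRay v (tropDir j) ∪
        segment ℝ v (v + t • (tropDir k + tropDir l)) ∪
        tropRay (v + t • (tropDir k + tropDir l)) (tropDir k) ∪
        tropRay (v + t • (tropDir k + tropDir l)) (tropDir l)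
      = TL i j k l (hom v i) (hom v j) (hom v k) (hom v l) t := by
  have hj : Dist4 j i k l := by unfold Dist4 at *; tauto
  have hk : Dist4 k i j l := by unfold Dist4 at *; tauto
  have hl : Dist4 l i j k := by unfold Dist4 at *; tauto
  ext x
  simp only [Set.mem_union, mem_tropRay h, mem_tropRay hj, mem_tropRay hk, mem_tropRay hl,
    mem_seg h v x ht, TL, Set.mem_setOf_eq, hom_w]
  obtain ⟨hij, hik, hil, hjk, hjl, hkl⟩ := h
  simp only [hik, hil, hjk, hjl, hkl, hkl.symm, if_false, if_true]
  generalize (if k = 3 then t else 0) + (if l = 3 then t else 0) = c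
  constructor
  · rintro ((((h | h) | h) | ⟨h1, h2, h3⟩) | ⟨h1, h2, h3⟩)
    · exact Or.inl h
    · exact Or.inr (Or.inl h)
    · exact Or.inr (Or.inr (Or.inl h))
    · exact Or.inr (Or.inr (Or.inr (Or.inl ⟨by linarith, by linarith, by linarith⟩)))
    · exact Or.inr (Or.inr (Or.inr (Or.inr ⟨by linarith, by linarith, by linarith⟩)))
  · rintro (h | h | h | ⟨h1, h2, h3⟩ | ⟨h1, h2, h3⟩)
    · exact Or.inl (Or.inl (Or.inl (Or.inl h)))
    · exact Or.inl (Or.inl (Or.inl (Or.inr h)))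
    · exact Or.inl (Or.inl (Or.inr h))
    · exact Or.inl (Or.inr ⟨by linarith, by linarith, by linarith⟩)
    · exact Or.inr ⟨by linarith, by linarith, by linarith⟩

lemma TL_shift (i j k l : Fin 4) {a b c d t a' b' c' d' t' : ℝ} (e : ℝ) (ha : a' = a + e)
    (hb : b' = b + e) (hc : c' = c + e) (hd : d' = d + e) (ht : t' = t) :
    TL i j k l a b c d t = TL i j k l a' b' c' d' t' := by
  subst ha hb hc hd ht
  ext x
  simp only [TL, Set.mem_setOf_eq, ← sub_sub, sub_left_inj, sub_le_sub_iff_right]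
  have e1 : ∀ y z : ℝ, y - e = z - e + t' ↔ y = z + t' := fun y z =>
    ⟨fun h => by linarith, fun h => by linarith⟩
  have e2 : ∀ y z : ℝ, y - e ≤ z - e + t' ↔ y ≤ z + t' := fun y z =>
    ⟨fun h => by linarith, fun h => by linarith⟩
  simp only [e1, e2]

lemma exists_hom (a : Fin 4 → ℝ) : ∃ (v : Fin 3 → ℝ) (e : ℝ), ∀ m, a m = hom v m + e := by
  refine ⟨![a 0 - a 3, a 1 - a 3, a 2 - a 3], a 3, ?_⟩
  intro m
  fin_cases m <;> simp [hom]

lemma TL_isTropicalLine {i j k l : Fin 4} (h : Dist4 i j k l) (a b c d : ℝ) {t : ℝ}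
    (ht : 0 < t) : IsTropicalLine (TL i j k l a b c d t) := by
  right
  obtain ⟨v, e, hv⟩ := exists_hom
    (fun m => if m = i then a else if m = j then b else if m = k then c else d)
  have h' := h
  obtain ⟨hij, hik, hil, hjk, hjl, hkl⟩ := h'
  have hi := hv i
  have hj := hv j
  have hk := hv k
  have hl := hv l
  simp only [hij.symm, hik.symm, hil.symm, hjk.symm, hjl.symm, hkl.symm, if_true, if_false]
    at hi hj hk hl
  refine ⟨v, t, i, j, k, l, ht, (dist4_iff _ _ _ _).2 h, ?_⟩
  rw [nondeg_eq h v ht]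
  exact (TL_shift i j k l e hi hj hk hl rfl).symm

lemma isTropicalLine_TL {L : Set (Fin 3 → ℝ)} (hL : IsTropicalLine L) :
    ∃ (i j k l : Fin 4) (a b c d t : ℝ), Dist4 i j k l ∧ 0 ≤ t ∧ L = TL i j k l a b c d t := by
  rcases hL with ⟨v, rfl⟩ | ⟨v, t, i, j, k, l, ht, hu, rfl⟩
  · refine ⟨0, 1, 2, 3, hom v 0, hom v 1, hom v 2, hom v 3, 0, by unfold Dist4; decide,
      le_rfl, ?_⟩
    ext x
    have h0 : Dist4 0 1 2 3 := by unfold Dist4; decide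
    have h1 : Dist4 1 0 2 3 := by unfold Dist4; decide
    have h2 : Dist4 2 0 1 3 := by unfold Dist4; decide
    have h3 : Dist4 3 0 1 2 := by unfold Dist4; decide
    have e : x ∈ (⋃ i : Fin 4, tropRay v (tropDir i)) ↔
        x ∈ tropRay v (tropDir 0) ∨ x ∈ tropRay v (tropDir 1) ∨ x ∈ tropRay v (tropDir 2) ∨
        x ∈ tropRay v (tropDir 3) := by
      rw [Set.mem_iUnion]
      constructor
      · rintro ⟨i, hi⟩
        fin_cases i
        · exact Or.inl hi
        · exact Or.inr (Or.inl hi)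
        · exact Or.inr (Or.inr (Or.inl hi))
        · exact Or.inr (Or.inr (Or.inr hi))
      · rintro (h | h | h | h)
        exacts [⟨_, h⟩, ⟨_, h⟩, ⟨_, h⟩, ⟨_, h⟩]
    rw [e, mem_tropRay h0, mem_tropRay h1, mem_tropRay h2, mem_tropRay h3]
    simp only [TL, Set.mem_setOf_eq, add_zero]
    constructor
    · rintro (h | h | ⟨h1, h2, h3⟩ | ⟨h1, h2, h3⟩)
      · exact Or.inl h
      · exact Or.inr (Or.inl h)
      · exact Or.inr (Or.inr (Or.inr (Or.inl ⟨by linarith, by linarith, by linarith⟩)))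
      · exact Or.inr (Or.inr (Or.inr (Or.inr ⟨by linarith, by linarith, by linarith⟩)))
    · rintro (h | h | ⟨h1, h2, h3, h4⟩ | ⟨h1, h2, h3⟩ | ⟨h1, h2, h3⟩)
      · exact Or.inl h
      · exact Or.inr (Or.inl h)
      · exact Or.inl ⟨by linarith, by linarith, by linarith⟩
      · exact Or.inr (Or.inr (Or.inl ⟨by linarith, by linarith, by linarith⟩))
      · exact Or.inr (Or.inr (Or.inr ⟨by linarith, by linarith, by linarith⟩))
  · have h := (dist4_iff _ _ _ _).1 hu
    exact ⟨i, j, k, l, _, _, _, _, t, h, ht.le, nondeg_eq h v ht⟩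

lemma TL_swap_ij (i j k l : Fin 4) (a b c d t : ℝ) :
    TL i j k l a b c d t = TL j i k l b a c d t := by
  ext x
  simp only [TL, Set.mem_setOf_eq]
  constructor
  · rintro (⟨h1, h2, h3⟩ | ⟨h1, h2, h3⟩ | ⟨h1, h2, h3, h4⟩ | ⟨h1, h2, h3⟩ | ⟨h1, h2, h3⟩)
    · exact Or.inr (Or.inl ⟨h1, h2, h3⟩)
    · exact Or.inl ⟨h1, h2, h3⟩
    · exact Or.inr (Or.inr (Or.inl ⟨h1.symm, h2, by linarith, by linarith⟩))
    · exact Or.inr (Or.inr (Or.inr (Or.inl ⟨h1.symm, by linarith, h3⟩)))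
    · exact Or.inr (Or.inr (Or.inr (Or.inr ⟨h1.symm, by linarith, h3⟩)))
  · rintro (⟨h1, h2, h3⟩ | ⟨h1, h2, h3⟩ | ⟨h1, h2, h3, h4⟩ | ⟨h1, h2, h3⟩ | ⟨h1, h2, h3⟩)
    · exact Or.inr (Or.inl ⟨h1, h2, h3⟩)
    · exact Or.inl ⟨h1, h2, h3⟩
    · exact Or.inr (Or.inr (Or.inl ⟨h1.symm, h2, by linarith, by linarith⟩))
    · exact Or.inr (Or.inr (Or.inr (Or.inl ⟨h1.symm, by linarith, h3⟩)))
    · exact Or.inr (Or.inr (Or.inr (Or.inr ⟨h1.symm, by linarith, h3⟩)))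

lemma TL_rev_sub (i j k l : Fin 4) (a b c d t : ℝ) :
    TL i j k l a b c d t ⊆ TL k l i j (c - t) (d - t) a b t := by
  intro x
  simp only [TL, Set.mem_setOf_eq]
  rintro (⟨h1, h2, h3⟩ | ⟨h1, h2, h3⟩ | ⟨h1, h2, h3, h4⟩ | ⟨h1, h2, h3⟩ | ⟨h1, h2, h3⟩)
  · exact Or.inr (Or.inr (Or.inr (Or.inl ⟨by linarith, by linarith, by linarith⟩)))
  · exact Or.inr (Or.inr (Or.inr (Or.inr ⟨by linarith, by linarith, by linarith⟩)))
  · exact Or.inr (Or.inr (Or.inl ⟨by linarith, by linarith, by linarith, by linarith⟩))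
  · exact Or.inl ⟨by linarith, by linarith, by linarith⟩
  · exact Or.inr (Or.inl ⟨by linarith, by linarith, by linarith⟩)

lemma TL_rev (i j k l : Fin 4) (a b c d t : ℝ) :
    TL i j k l a b c d t = TL k l i j (c - t) (d - t) a b t := by
  apply Set.Subset.antisymm (TL_rev_sub _ _ _ _ _ _ _ _ _)
  refine (TL_rev_sub _ _ _ _ _ _ _ _ _).trans ?_
  rw [TL_shift i j k l (a := a - t) (b := b - t) (c := c - t) (d := d - t) t]
  all_goals ring

lemma TL_swap_kl (i j k l : Fin 4) (a b c d t : ℝ) :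
    TL i j k l a b c d t = TL i j l k a b d c t := by
  rw [TL_rev, TL_swap_ij, TL_rev i j l k]

/-- Homogeneous coordinates of the difference. -/
def del (P Q : Fin 3 → ℝ) (m : Fin 4) : ℝ := hom Q m - hom P m

/-- The candidate line through `P` and `Q`. -/
def canon (P Q : Fin 3 → ℝ) (i j k l : Fin 4) : Set (Fin 3 → ℝ) :=
  TL i j k l (hom Q i - hom Q j + hom P j) (hom P j) (hom P k) (hom P l) (del P Q j - del P Q l)

/-- `i, j, l, k` sorts the difference strictly. -/
def Srt (P Q : Fin 3 → ℝ) (i j k l : Fin 4) : Prop :=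
  Dist4 i j k l ∧ del P Q j < del P Q i ∧ del P Q l < del P Q j ∧ del P Q k < del P Q l

lemma canon_of {P Q : Fin 3 → ℝ} {i j k l : Fin 4} {a b c d t : ℝ} (h : Dist4 i j k l)
    (ht : 0 ≤ t) (hg : ∀ m n, m ≠ n → del P Q m ≠ del P Q n)
    (hP : hom P j - b = hom P k - c ∧ hom P k - c = hom P l - d ∧ hom P i - a ≤ hom P j - b)
    (hQ : hom Q i - a = hom Q j - b ∧ hom Q j - b = hom Q l - d + t ∧
      hom Q k - c ≤ hom Q l - d) :
    Srt P Q i j k l ∧ TL i j k l a b c d t = canon P Q i j k l := by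
  obtain ⟨p1, p2, p3⟩ := hP
  obtain ⟨q1, q2, q3⟩ := hQ
  refine ⟨⟨h, ?_, ?_, ?_⟩, ?_⟩
  · refine lt_of_le_of_ne ?_ (hg _ _ h.1.symm)
    simp only [del]; linarith
  · refine lt_of_le_of_ne ?_ (hg _ _ h.2.2.2.2.1.symm)
    simp only [del]; linarith
  · refine lt_of_le_of_ne ?_ (hg _ _ h.2.2.2.2.2)
    simp only [del]; linarith
  · unfold canon
    apply TL_shift i j k l (hom P j - b) <;> (try unfold del) <;> linarith

lemma canon_swap {P Q : Fin 3 → ℝ} {i j k l : Fin 4} (h : Srt Q P i j k l) :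
    Srt P Q k l i j ∧ canon Q P i j k l = canon P Q k l i j := by
  obtain ⟨h, h1, h2, h3⟩ := h
  unfold del at h1 h2 h3
  refine ⟨⟨?_, ?_, ?_, ?_⟩, ?_⟩
  · unfold Dist4 at *; tauto
  · unfold del; linarith
  · unfold del; linarith
  · unfold del; linarith
  · unfold canon
    rw [TL_rev]
    apply TL_shift k l i j (hom P j - hom Q j) <;> (try unfold del) <;> ring

/-- `P` on a ray at the first vertex, everything else. -/
lemma canon_left {P Q : Fin 3 → ℝ} {i j k l : Fin 4} {a b c d t : ℝ} (h : Dist4 i j k l)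
    (ht : 0 ≤ t) (hg : ∀ m n, m ≠ n → del P Q m ≠ del P Q n)
    (hP : hom P j - b = hom P k - c ∧ hom P k - c = hom P l - d ∧ hom P i - a ≤ hom P j - b)
    (hQ : Q ∈ TL i j k l a b c d t) :
    ∃ i' j' k' l', Srt P Q i' j' k' l' ∧ TL i j k l a b c d t = canon P Q i' j' k' l' := by
  have hkl := hg k l h.2.2.2.2.2
  rcases hQ with h' | h' | h' | h' | h'
  · exact absurd (by unfold del; linarith [h'.2.1, hP.2.1]) hkl
  · exact absurd (by unfold del; linarith [h'.2.1, hP.2.1]) hkl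
  · exact absurd (by unfold del; linarith [h'.2.1, hP.2.1]) hkl
  · exact ⟨i, j, k, l, canon_of h ht hg hP h'⟩
  · have h2 : Dist4 i j l k := by unfold Dist4 at *; tauto
    rw [TL_swap_kl]
    exact ⟨i, j, l, k, canon_of h2 ht hg
      ⟨by linarith [hP.1, hP.2.1], hP.2.1.symm, hP.2.2⟩ h'⟩

lemma canon_left' {P Q : Fin 3 → ℝ} {i j k l : Fin 4} {a b c d t : ℝ} (h : Dist4 i j k l)
    (ht : 0 ≤ t) (hg : ∀ m n, m ≠ n → del P Q m ≠ del P Q n)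
    (hP : (hom P j - b = hom P k - c ∧ hom P k - c = hom P l - d ∧ hom P i - a ≤ hom P j - b) ∨
      (hom P i - a = hom P k - c ∧ hom P k - c = hom P l - d ∧ hom P j - b ≤ hom P i - a))
    (hQ : Q ∈ TL i j k l a b c d t) :
    ∃ i' j' k' l', Srt P Q i' j' k' l' ∧ TL i j k l a b c d t = canon P Q i' j' k' l' := by
  rcases hP with hP | hP
  · exact canon_left h ht hg hP hQ
  · have h2 : Dist4 j i k l := by unfold Dist4 at *; tauto
    rw [TL_swap_ij] at hQ ⊢
    exact canon_left h2 ht hg hP hQ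

lemma canon_all {P Q : Fin 3 → ℝ} {i j k l : Fin 4} {a b c d t : ℝ} (h : Dist4 i j k l)
    (ht : 0 ≤ t) (hg : ∀ m n, m ≠ n → del P Q m ≠ del P Q n)
    (hP : P ∈ TL i j k l a b c d t) (hQ : Q ∈ TL i j k l a b c d t) :
    ∃ i' j' k' l', Srt P Q i' j' k' l' ∧ TL i j k l a b c d t = canon P Q i' j' k' l' := by
  have hr : Dist4 k l i j := by unfold Dist4 at *; tauto
  have hP' := hP
  rcases hP' with h' | h' | h' | h' | h'
  · exact canon_left' h ht hg (Or.inl h') hQ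
  · exact canon_left' h ht hg (Or.inr h') hQ
  · have hg' : ∀ m n, m ≠ n → del Q P m ≠ del Q P n := by
      intro m n hmn e
      apply hg m n hmn
      unfold del at *
      linarith
    have key : ∃ i' j' k' l', Srt Q P i' j' k' l' ∧
        TL i j k l a b c d t = canon Q P i' j' k' l' := by
      have hQ' := hQ
      rcases hQ' with h'' | h'' | h'' | h'' | h''
      · exact canon_left' h ht hg' (Or.inl h'') hP
      · exact canon_left' h ht hg' (Or.inr h'') hP
      · exact absurd (by unfold del; linarith [h'.1, h''.1]) (hg i j h.1)
      · rw [TL_rev] at hP ⊢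
        exact canon_left' hr ht hg' (Or.inl ⟨by linarith [h''.1, h''.2.1],
          by linarith [h''.1, h''.2.1], by linarith [h''.2.2]⟩) hP
      · rw [TL_rev] at hP ⊢
        exact canon_left' hr ht hg' (Or.inr ⟨by linarith [h''.1, h''.2.1],
          by linarith [h''.1, h''.2.1], by linarith [h''.2.2]⟩) hP
    obtain ⟨i', j', k', l', hs, e⟩ := key
    exact ⟨k', l', i', j', (canon_swap hs).1, e.trans (canon_swap hs).2⟩
  · rw [TL_rev] at hQ ⊢
    exact canon_left' hr ht hg (Or.inl ⟨by linarith [h'.1, h'.2.1],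
      by linarith [h'.1, h'.2.1], by linarith [h'.2.2]⟩) hQ
  · rw [TL_rev] at hQ ⊢
    exact canon_left' hr ht hg (Or.inr ⟨by linarith [h'.1, h'.2.1],
      by linarith [h'.1, h'.2.1], by linarith [h'.2.2]⟩) hQ

lemma srt_unique {P Q : Fin 3 → ℝ} {i j k l i' j' k' l' : Fin 4} (h : Srt P Q i j k l)
    (h' : Srt P Q i' j' k' l') : i = i' ∧ j = j' ∧ k = k' ∧ l = l' := by
  obtain ⟨h, h1, h2, h3⟩ := h
  obtain ⟨g, g1, g2, g3⟩ := h'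
  have ci := h.cover i'
  have cj := h.cover j'
  have ck := h.cover k'
  have cl := h.cover l'
  rcases ci with rfl | rfl | rfl | rfl <;> rcases cj with rfl | rfl | rfl | rfl <;>
    first
    | (exfalso; linarith)
    | (rcases ck with rfl | rfl | rfl | rfl <;> rcases cl with rfl | rfl | rfl | rfl <;>
        first
        | (exfalso; linarith)
        | exact ⟨rfl, rfl, rfl, rfl⟩)

lemma exists_sort (f : Fin 4 → ℝ) : ∃ i j k l, Dist4 i j k l ∧ f j ≤ f i ∧ f l ≤ f j ∧
    f k ≤ f l := by
  have hm := Tuple.monotone_sort f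
  have hi := (Tuple.sort f).injective
  refine ⟨Tuple.sort f 3, Tuple.sort f 2, Tuple.sort f 0, Tuple.sort f 1, ?_,
    hm (by decide), hm (by decide), hm (by decide)⟩
  refine ⟨hi.ne ?_, hi.ne ?_, hi.ne ?_, hi.ne ?_, hi.ne ?_, hi.ne ?_⟩ <;> decide

lemma TL_inj {i j k l : Fin 4} (h : Dist4 i j k l) {a b c d t t' : ℝ}
    (e : TL i j k l a b c d t = TL i j k l a b c d t') (ht : 0 ≤ t) : t = t' := by
  obtain ⟨v, r, hv⟩ := exists_hom
    (fun m => if m = i then a else if m = j then b else if m = k then c - t - 1 else d - t)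
  obtain ⟨hij, hik, hil, hjk, hjl, hkl⟩ := h
  have hi := hv i
  have hj := hv j
  have hk := hv k
  have hl := hv l
  simp only [hij.symm, hik.symm, hil.symm, hjk.symm, hjl.symm, hkl.symm, if_true, if_false]
    at hi hj hk hl
  have hm : v ∈ TL i j k l a b c d t :=
    Or.inr (Or.inr (Or.inr (Or.inl ⟨by linarith, by linarith, by linarith⟩)))
  rw [e] at hm
  rcases hm with ⟨h1, h2, h3⟩ | ⟨h1, h2, h3⟩ | ⟨h1, h2, h3, h4⟩ | ⟨h1, h2, h3⟩ | ⟨h1, h2, h3⟩ <;>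
    linarith

lemma infinite_of {P Q : Fin 3 → ℝ} {i j k l : Fin 4} (h : Dist4 i j k l) (a b c d T : ℝ)
    (hT : 0 ≤ T)
    (hm : ∀ t, T ≤ t → P ∈ TL i j k l a b c d t ∧ Q ∈ TL i j k l a b c d t) :
    {L : Set (Fin 3 → ℝ) | IsTropicalLine L ∧ P ∈ L ∧ Q ∈ L}.Infinite := by
  refine Set.infinite_of_injective_forall_mem
    (f := fun n : ℕ => TL i j k l a b c d (T + 1 + n)) ?_ ?_
  · intro m n e
    have := TL_inj h e (by positivity)
    have h2 : (m : ℝ) = n := by linarith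
    exact_mod_cast h2
  · intro n
    have hn : (0 : ℝ) ≤ n := n.cast_nonneg
    exact ⟨TL_isTropicalLine h a b c d (by linarith), hm _ (by linarith)⟩

lemma infinite_case {P Q : Fin 3 → ℝ} (hg : ∃ m n, m ≠ n ∧ del P Q m = del P Q n) :
    {L : Set (Fin 3 → ℝ) | IsTropicalLine L ∧ P ∈ L ∧ Q ∈ L}.Infinite := by
  obtain ⟨i, j, k, l, h, h1, h2, h3⟩ := exists_sort (del P Q)
  have key : del P Q i = del P Q j ∨ del P Q j = del P Q l ∨ del P Q l = del P Q k := by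
    by_contra hc
    push Not at hc
    obtain ⟨c1, c2, c3⟩ := hc
    have d1 := lt_of_le_of_ne h1 c1.symm
    have d2 := lt_of_le_of_ne h2 c2.symm
    have d3 := lt_of_le_of_ne h3 c3.symm
    obtain ⟨m, n, hmn, e⟩ := hg
    rcases h.cover m with rfl | rfl | rfl | rfl <;> rcases h.cover n with rfl | rfl | rfl | rfl <;>
      first
      | exact hmn rfl
      | linarith
  unfold del at h1 h2 h3 key
  rcases key with e | e | e
  · have hr : Dist4 k l i j := by unfold Dist4 at *; tauto
    refine infinite_of hr (hom P k - hom P l + hom Q l) (hom Q l) (hom Q i) (hom Q j)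
      (del P Q i - del P Q l) (by unfold del; linarith) ?_
    intro t ht
    unfold del at ht
    exact ⟨Or.inr (Or.inr (Or.inl ⟨by linarith, by linarith, by linarith, by linarith⟩)),
      Or.inl ⟨by linarith, by linarith, by linarith⟩⟩
  · have hr : Dist4 i k j l := by unfold Dist4 at *; tauto
    refine infinite_of hr (hom Q i - hom Q j + hom P j) (hom P k) (hom P j) (hom P l)
      0 le_rfl ?_
    intro t ht
    exact ⟨Or.inl ⟨by linarith, by linarith, by linarith⟩,
      Or.inr (Or.inl ⟨by linarith, by linarith, by linarith⟩)⟩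
  · refine infinite_of h (hom Q i - hom Q j + hom P j) (hom P j) (hom P k) (hom P l)
      (del P Q j - del P Q k) (by unfold del; linarith) ?_
    intro t ht
    unfold del at ht
    exact ⟨Or.inl ⟨by linarith, by linarith, by linarith⟩,
      Or.inr (Or.inr (Or.inl ⟨by linarith, by linarith, by linarith, by linarith⟩))⟩

lemma unique_case {P Q : Fin 3 → ℝ} (hg : ∀ m n, m ≠ n → del P Q m ≠ del P Q n) :
    ∃! L : Set (Fin 3 → ℝ), IsTropicalLine L ∧ P ∈ L ∧ Q ∈ L := by
  obtain ⟨i, j, k, l, h, h1, h2, h3⟩ := exists_sort (del P Q)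
  have d1 := lt_of_le_of_ne h1 (hg _ _ h.1.symm)
  have d2 := lt_of_le_of_ne h2 (hg _ _ h.2.2.2.2.1.symm)
  have d3 := lt_of_le_of_ne h3 (hg _ _ h.2.2.2.2.2)
  refine ⟨canon P Q i j k l, ⟨TL_isTropicalLine h _ _ _ _ (by linarith), ?_, ?_⟩, ?_⟩
  · unfold del at d1 d2 d3
    exact Or.inl ⟨by linarith, by linarith, by linarith⟩
  · unfold del at d1 d2 d3
    exact Or.inr (Or.inr (Or.inr (Or.inl
      ⟨by linarith, by unfold del; linarith, by linarith⟩)))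
  · rintro L ⟨hL, hP, hQ⟩
    obtain ⟨i', j', k', l', a, b, c, d, t, h', ht, rfl⟩ := isTropicalLine_TL hL
    obtain ⟨i₂, j₂, k₂, l₂, hs, e⟩ := canon_all h' ht hg hP hQ
    obtain ⟨rfl, rfl, rfl, rfl⟩ := srt_unique hs ⟨h, d1, d2, d3⟩
    exact e

lemma cond_iff (P Q : Fin 3 → ℝ) :
    ((∃ i : Fin 3, (Q - P) i = 0) ∨ (∃ i j : Fin 3, i ≠ j ∧ (Q - P) i = (Q - P) j)) ↔
      ∃ m n, m ≠ n ∧ del P Q m = del P Q n := by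
  have hc : ∀ i : Fin 3, del P Q i.castSucc = (Q - P) i := by
    intro i
    fin_cases i <;> simp [del, hom]
  have hl : del P Q (Fin.last 3) = 0 := by
    simp [del, hom, Fin.last]
  constructor
  · rintro (⟨i, hi⟩ | ⟨i, j, hij, e⟩)
    · exact ⟨i.castSucc, Fin.last 3, (Fin.castSucc_lt_last i).ne, by rw [hc, hl, hi]⟩
    · exact ⟨i.castSucc, j.castSucc, fun h => hij (Fin.castSucc_injective _ h),
        by rw [hc, hc, e]⟩
  · rintro ⟨m, n, hmn, e⟩
    induction m using Fin.lastCases with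
    | last =>
      induction n using Fin.lastCases with
      | last => exact absurd rfl hmn
      | cast j => exact Or.inl ⟨j, by rw [← hc, ← e, hl]⟩
    | cast i =>
      induction n using Fin.lastCases with
      | last => exact Or.inl ⟨i, by rw [← hc, e, hl]⟩
      | cast j => exact Or.inr ⟨i, j, fun h => hmn (by rw [h]), by rw [← hc, ← hc, e]⟩

/-- Lemma 3.4: there are infinitely many tropical lines through `P` and `Q` iff some coordinate
of `Q - P` is zero or two of its coordinates coincide; otherwise the tropical line through
`P` and `Q` is unique. -/
theorem infinitely_many_tropical_lines_iff (P Q : Fin 3 → ℝ) :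
    ({L : Set (Fin 3 → ℝ) | IsTropicalLine L ∧ P ∈ L ∧ Q ∈ L}.Infinite ↔
      (∃ i : Fin 3, (Q - P) i = 0) ∨
      (∃ i j : Fin 3, i ≠ j ∧ (Q - P) i = (Q - P) j)) ∧
    (¬ ((∃ i : Fin 3, (Q - P) i = 0) ∨
        (∃ i j : Fin 3, i ≠ j ∧ (Q - P) i = (Q - P) j)) →
      ∃! L : Set (Fin 3 → ℝ), IsTropicalLine L ∧ P ∈ L ∧ Q ∈ L) := by
  rw [cond_iff]
  have hu : ¬ (∃ m n, m ≠ n ∧ del P Q m = del P Q n) →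
      ∃! L : Set (Fin 3 → ℝ), IsTropicalLine L ∧ P ∈ L ∧ Q ∈ L := by
    intro hn
    exact unique_case fun m n hmn e => hn ⟨m, n, hmn, e⟩
  refine ⟨⟨?_, infinite_case⟩, hu⟩
  intro hinf
  by_contra hn
  obtain ⟨L, _, hL⟩ := hu hn
  exact hinf ((Set.finite_singleton L).subset fun M hM => hL M hM)
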